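/- T_{max,2}(19) = 89 and T_{max,3}(19) = 123; in particular, for l = 19 the function m1 ↦ T_{max,m1}(19) is strictly increasing on {1, 2, 3}. -/

import Mathlib

open MvPolynomial

/-- A monomial ideal: an ideal containing the monomials of all its elements. -/
def IsMonomialIdeal (I : Ideal (MvPolynomial (Fin 3) ℂ)) : Prop :=
  ∀ p ∈ I, ∀ d ∈ p.support, (monomial d (1 : ℂ)) ∈ I

/-- Borel-fixed (strongly stable) in characteristic 0: for every monomial in `I`
divisible by `x_j`, and every `i < j`, replacing one factor `x_j` by `x_i`
stays in `I`. -/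
def IsBorelFixed (I : Ideal (MvPolynomial (Fin 3) ℂ)) : Prop :=
  ∀ d : Fin 3 →₀ ℕ, (monomial d (1 : ℂ)) ∈ I →
    ∀ i j : Fin 3, i < j → 0 < d j →
      (monomial (d + Finsupp.single i 1 - Finsupp.single j 1) (1 : ℂ)) ∈ I

/-- The dimension of the tangent space to the Hilbert scheme at `[I]`,
namely `dim_ℂ Hom_R(I, R/I)`. -/
noncomputable def tangentDim (I : Ideal (MvPolynomial (Fin 3) ℂ)) : ℕ :=
  Module.finrank ℂ (↥I →ₗ[MvPolynomial (Fin 3) ℂ] (MvPolynomial (Fin 3) ℂ ⧸ I))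

/-- `TmaxEq l m1 T` says that `T` is the maximum of `dim_ℂ Hom_R(I, R/I)` over all
Borel-fixed monomial ideals `I ⊆ ℂ[x,y,z]` of colength `l` whose smallest pure power
of `x` lying in `I` is `x^{m1}`. -/
def TmaxEq (l m1 T : ℕ) : Prop :=
  IsGreatest { t : ℕ | ∃ I : Ideal (MvPolynomial (Fin 3) ℂ),
      IsMonomialIdeal I ∧ IsBorelFixed I ∧
      Module.finrank ℂ (MvPolynomial (Fin 3) ℂ ⧸ I) = l ∧
      (X 0 : MvPolynomial (Fin 3) ℂ) ^ m1 ∈ I ∧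
      (X 0 : MvPolynomial (Fin 3) ℂ) ^ (m1 - 1) ∉ I ∧
      t = tangentDim I } T

/-- The entries of an exponent vector in the variables `x`, `y`, `z`. -/
abbrev Triple := Nat × Nat × Nat

namespace Staircase

/-- The number of standard monomials `x ^ a * y ^ b * z ^ c`; the list `L` holds five columns for
each value of `a`. -/
def height (L : List Nat) (a b : Nat) : Nat := if b < 5 then L.getD (5 * a + b) 0 else 0

/-- The exponents of the standard monomials. -/
def cells (L : List Nat) : List Triple :=
  (List.range 3).flatMap fun a => (List.range 5).flatMap fun b =>
    (List.range (height L a b)).map fun c => (a, b, c)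

/-- An additive code of triples, injective on small triples. -/
def code (t : Triple) : Nat := t.1 * 1024 + t.2.1 * 64 + t.2.2

/-- The codes of the triples in `l`, as the bits of a number. -/
def cellMask (l : List Triple) : Nat := l.foldr (fun t m => m ||| (1 <<< code t)) 0

/-- The maximum, in a form on which the kernel computes well. -/
def larger (a b : Nat) : Nat := bif a.ble b then b else a

/-- The exponent of the least common multiple. -/
def join (g h : Triple) : Triple := (larger g.1 h.1, larger g.2.1 h.2.1, larger g.2.2 h.2.2)

/-- Application of `f` to `n` that makes the kernel evaluate `n` first. -/
def force {α : Type} (n : Nat) (f : Nat → α) : α :=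
  match n with
  | 0 => f 0
  | m + 1 => f (m + 1)

/-- The bits of `M` at the places whose translate down by `w` is not in `M`. -/
def overshoot (M w : Nat) : Nat := M ^^^ (M &&& (M <<< w))

/-- The codes of the positions at which the value on `g` is determined by the value on `h`. -/
def killEarlier (M : Nat) (g h : Triple) : Nat :=
  force (code g) fun cg => force (code (join g h)) fun cj => M >>> (cj - cg)

/-- The codes of the positions at which the relation between `g` and `h` makes the value on `g`
vanish. -/
def killAny (M : Nat) (g h : Triple) : Nat :=
  force (code g) fun cg => force (code h) fun ch => force (code (join g h)) fun cj =>
    (overshoot M (cj - ch)) >>> (cj - cg)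

/-- The bitwise disjunction of the values of `f` on a list, starting from an accumulator. -/
def orAll (f : Triple → Nat) (l : List Triple) : Nat → Nat :=
  List.rec (motive := fun _ => Nat → Nat) (fun acc => acc)
    (fun h _ ih acc => force (acc ||| f h) ih) l

/-- The codes of the positions at which the value on `g` vanishes as soon as the values on `done`
do. -/
def killMask (M : Nat) (G done : List Triple) (g : Triple) : Nat :=
  orAll (killAny M g) G (orAll (killEarlier M g) done 0)

/-- The positions that are not eliminated when the generators in `todo` are treated in turn. -/
def survivors (M : Nat) (C G : List Triple) : List Triple → List Triple → List (Triple × Triple)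
  | _, [] => []
  | done, g :: todo =>
    (force (killMask M G done g) fun K =>
      (C.filter fun s => (K >>> code s % 2).beq 0).map fun s => (g, s))
      ++ survivors M C G (g :: done) todo

/-- Generators of the ideal, ordered so that few positions survive; the minimal ones by default. -/
def gens (L : List Nat) : List Triple :=
  if L = [6, 4, 2, 1, 0, 3, 2, 1, 0, 0, 0, 0, 0, 0, 0] then
    [(2, 0, 0), (1, 1, 2), (1, 0, 3), (1, 2, 1), (1, 3, 0), (0, 0, 6), (0, 1, 4), (0, 2, 2),
      (0, 3, 1), (0, 4, 0)]
  else if L = [5, 4, 3, 1, 0, 3, 2, 1, 0, 0, 0, 0, 0, 0, 0] then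
    [(2, 0, 0), (0, 1, 4), (0, 0, 5), (0, 2, 3), (0, 3, 1), (0, 4, 0), (1, 1, 2), (1, 2, 1),
      (1, 0, 3), (1, 3, 0)]
  else if L = [4, 3, 2, 1, 0, 3, 2, 1, 0, 0, 2, 1, 0, 0, 0] then
    [(2, 2, 0), (3, 0, 0), (2, 0, 2), (2, 1, 1), (1, 0, 3), (1, 1, 2), (1, 2, 1), (1, 3, 0),
      (0, 0, 4), (0, 1, 3), (0, 2, 2), (0, 3, 1), (0, 4, 0)]
  else
    [3, 2, 1, 0].flatMap fun a => (List.range 6).filterMap fun b =>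
      force (height L a b) fun c =>
        bif (a.beq 0 || c.blt (height L (a - 1) b)) &&
            (b.beq 0 || c.blt (height L a (b - 1))) then
          some (a, b, c) else none

/-- The elements of `G` lie in the ideal, and they generate it. -/
def validGens (L : List Nat) (G : List Triple) : Bool :=
  (G.all fun g => g.1.ble 3 && g.2.1.ble 5 && g.2.2.ble 19 && (height L g.1 g.2.1).ble g.2.2) &&
  (List.range 4).all fun a => (List.range 6).all fun b => force (height L a b) fun c =>
    G.any fun g => g.1.ble a && g.2.1.ble b && g.2.2.ble c

/-- The bound on the dimension of the tangent space, in terms of the smallest power of `x`. -/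
def target (L : List Nat) : Nat :=
  bif (height L 1 0).beq 0 then 88 else bif (height L 2 0).beq 0 then 89 else 123

/-- The positions that determine a homomorphism, for the order of generators `G`. -/
def survivorsOf (L : List Nat) (G : List Triple) : List (Triple × Triple) :=
  force (cellMask (cells L)) fun M => survivors M (cells L) G [] G

/-- The number of survivors obeys the bound. -/
def check (L : List Nat) : Bool :=
  validGens L (gens L) && (survivorsOf L (gens L)).length.ble (target L)

/-- A bound for the next height, given the list of the previous ones in reverse order. -/
def bound : List Nat → Nat
  | [] => 19
  | v :: p =>
    force p.length fun k =>
      if k < 4 then v - 1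
      else if k % 5 = 4 then p.getD 2 0
      else if k % 5 = 3 then 0
      else min (v - 1) (p.getD 2 0)

/-- The predicate holds up to the given number. -/
def allBelow (q : Nat → Bool) : Nat → Bool
  | 0 => q 0
  | n + 1 => q (n + 1) && allBelow q n

/-- The predicate holds for all lists extending `l` by `n` heights with sum `r` that obey the
bounds. -/
def allExtensions (p : List Nat → Bool) : Nat → List Nat → Nat → Bool
  | 0, l, r => !(r.beq 0) || p l.reverse
  | n + 1, l, r =>
    allBelow (fun v => force (r - v) fun r' => allExtensions p n (v :: l) r') (min r (bound l))

theorem force_eq {α : Type} (n : ℕ) (f : ℕ → α) : force n f = f n := by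
  cases n <;> rfl

theorem larger_eq (a b : ℕ) : larger a b = max a b := by
  unfold larger
  rcases h : a.ble b with _ | _
  · have : ¬ a ≤ b := fun hab => by simp [Nat.ble_eq_true_of_le hab] at h
    simp; omega
  · have := Nat.le_of_ble_eq_true h
    simp; omega

theorem mem_cells {L : List ℕ} {t : Triple} :
    t ∈ cells L ↔ t.1 < 3 ∧ t.2.1 < 5 ∧ t.2.2 < height L t.1 t.2.1 := by
  obtain ⟨a, b, c⟩ := t
  simp only [cells, List.mem_flatMap, List.mem_range, List.mem_map, Prod.mk.injEq]
  constructor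
  · rintro ⟨a', ha, b', hb, c', hc, rfl, rfl, rfl⟩
    exact ⟨ha, hb, hc⟩
  · rintro ⟨ha, hb, hc⟩
    exact ⟨a, ha, b, hb, c, hc, rfl, rfl, rfl⟩

theorem testBit_cellMask (l : List Triple) (n : ℕ) :
    (cellMask l).testBit n = true ↔ ∃ t ∈ l, code t = n := by
  induction l with
  | nil => simp [cellMask]
  | cons t l ih =>
    have : cellMask (t :: l) = cellMask l ||| (1 <<< code t) := rfl
    rw [this, Nat.testBit_or, Bool.or_eq_true, ih, Nat.one_shiftLeft, Nat.testBit_two_pow,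
      decide_eq_true_eq, List.exists_mem_cons_iff, or_comm]

theorem testBit_orAll (f : Triple → ℕ) (l : List Triple) (acc n : ℕ) :
    (orAll f l acc).testBit n = true ↔ acc.testBit n = true ∨ ∃ h ∈ l, (f h).testBit n = true := by
  induction l generalizing acc with
  | nil => simp [orAll]
  | cons h l ih =>
    have : orAll f (h :: l) acc = orAll f l (acc ||| f h) :=
      force_eq (acc ||| f h) (orAll f l)
    rw [this, ih]
    simp [Nat.testBit_or, or_assoc]

theorem code_join_sub_left (g h : Triple) :
    code (join g h) - code g = code (join g h - g) := by
  simp only [code, join, larger_eq, Prod.fst_sub, Prod.snd_sub]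
  omega

theorem code_join_sub_right (g h : Triple) :
    code (join g h) - code h = code (join g h - h) := by
  simp only [code, join, larger_eq, Prod.fst_sub, Prod.snd_sub]
  omega

theorem code_add (s t : Triple) : code (s + t) = code s + code t := by
  simp only [code, Prod.fst_add, Prod.snd_add]
  omega

theorem join_sub_add_left (g h : Triple) : join g h - g + g = join g h := by
  ext <;> simp [join, larger_eq]

theorem join_sub_add_right (g h : Triple) : join g h - h + h = join g h := by
  ext <;> simp [join, larger_eq]

/-- The region in which generators are looked for. -/
def InBox (g : Triple) : Prop := g.1 ≤ 3 ∧ g.2.1 ≤ 5 ∧ g.2.2 ≤ 19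

theorem mem_cells_of_code_eq {L : List ℕ} (hL : ∀ a b, height L a b ≤ 19) {s g h t : Triple}
    (hs : s ∈ cells L) (hg : InBox g) (hh : InBox h) (ht : t ∈ cells L)
    (e : code t = code (join g h - g) + code s) : s + (join g h - g) ∈ cells L := by
  suffices s + (join g h - g) = t by rwa [this]
  obtain ⟨s1, s2, s3⟩ := mem_cells.1 hs
  obtain ⟨t1, t2, t3⟩ := mem_cells.1 ht
  have hs' := hL s.1 s.2.1
  have ht' := hL t.1 t.2.1
  obtain ⟨g1, g2, g3⟩ := hg
  obtain ⟨h1, h2, h3⟩ := hh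
  simp only [code, join, larger_eq, Prod.fst_sub, Prod.snd_sub] at e
  ext <;> simp only [join, larger_eq, Prod.fst_sub, Prod.snd_sub, Prod.fst_add, Prod.snd_add] <;>
    omega

theorem add_mem_of_killEarlier {L : List ℕ} (hL : ∀ a b, height L a b ≤ 19) {s g h : Triple}
    (hs : s ∈ cells L) (hg : InBox g) (hh : InBox h)
    (hk : (killEarlier (cellMask (cells L)) g h).testBit (code s) = true) :
    s + (join g h - g) ∈ cells L := by
  simp only [killEarlier, force_eq, code_join_sub_left, Nat.testBit_shiftRight,
    testBit_cellMask] at hk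
  obtain ⟨t, ht, e⟩ := hk
  exact mem_cells_of_code_eq hL hs hg hh ht e

theorem add_mem_of_killAny {L : List ℕ} (hL : ∀ a b, height L a b ≤ 19)
    (hdown : ∀ t ∈ cells L, ∀ t' ≤ t, t' ∈ cells L) {s g h : Triple}
    (hs : s ∈ cells L) (hg : InBox g) (hh : InBox h)
    (hk : (killAny (cellMask (cells L)) g h).testBit (code s) = true) :
    s + (join g h - g) ∈ cells L ∧ ¬ join g h - h ≤ s + (join g h - g) := by
  simp only [killAny, force_eq, code_join_sub_left, code_join_sub_right, Nat.testBit_shiftRight,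
    overshoot, Nat.testBit_xor, Nat.testBit_and, Nat.testBit_shiftLeft] at hk
  have hM : (cellMask (cells L)).testBit (code (join g h - g) + code s) = true := by
    by_contra hcon
    simp [hcon] at hk
  have hmem : s + (join g h - g) ∈ cells L := by
    obtain ⟨t, ht, e⟩ := (testBit_cellMask _ _).1 hM
    exact mem_cells_of_code_eq hL hs hg hh ht e
  refine ⟨hmem, fun hle => ?_⟩
  have hsplit : code (join g h - g) + code s
      = code (join g h - h) + code (s + (join g h - g) - (join g h - h)) := by
    rw [← code_add, ← code_add, add_tsub_cancel_of_le hle, add_comm]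
  have hbit : (cellMask (cells L)).testBit
      (code (s + (join g h - g) - (join g h - h))) = true :=
    (testBit_cellMask _ _).2 ⟨_, hdown _ hmem _ tsub_le_self, rfl⟩
  rw [hM, hsplit] at hk
  simp [hbit] at hk

/-- If a family of relations `Z g s` is closed under the two elimination rules, then it holds
for all generators once it holds for the survivors. -/
theorem forall_of_survivors {L : List ℕ} (hL : ∀ a b, height L a b ≤ 19)
    (hdown : ∀ t ∈ cells L, ∀ t' ≤ t, t' ∈ cells L) {G : List Triple} (hG : ∀ g ∈ G, InBox g)
    (Z : Triple → Triple → Prop) (hout : ∀ g ∈ G, ∀ s ∉ cells L, Z g s)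
    (hearlier : ∀ g ∈ G, ∀ h ∈ G, ∀ s, s + (join g h - g) ∈ cells L → (∀ s', Z h s') → Z g s)
    (hany : ∀ g ∈ G, ∀ h ∈ G, ∀ s, s + (join g h - g) ∈ cells L →
      ¬ join g h - h ≤ s + (join g h - g) → Z g s)
    (done todo : List Triple) (hdone : ∀ g ∈ done, g ∈ G) (htodo : ∀ g ∈ todo, g ∈ G)
    (hZdone : ∀ g ∈ done, ∀ s, Z g s)
    (hsurv : ∀ q ∈ survivors (cellMask (cells L)) (cells L) G done todo, Z q.1 q.2) :
    ∀ g ∈ todo, ∀ s, Z g s := by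
  induction todo generalizing done with
  | nil => simp
  | cons g todo ih =>
    have hg : g ∈ G := htodo g (by simp)
    simp only [survivors, force_eq, List.mem_append, List.mem_map, List.mem_filter] at hsurv
    have hZg : ∀ s, Z g s := by
      intro s
      by_cases hs : s ∈ cells L
      · by_cases hk : (killMask (cellMask (cells L)) G done g).testBit (code s) = true
        · rw [killMask, testBit_orAll, testBit_orAll] at hk
          rcases hk with (hk | ⟨h, hh, hk⟩) | ⟨h, hh, hk⟩
          · simp at hk
          · exact hearlier g hg h (hdone h hh) s
              (add_mem_of_killEarlier hL hs (hG g hg) (hG h (hdone h hh)) hk) (hZdone h hh)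
          · obtain ⟨h1, h2⟩ := add_mem_of_killAny hL hdown hs (hG g hg) (hG h hh) hk
            exact hany g hg h hh s h1 h2
        · refine hsurv (g, s) (Or.inl ⟨s, ⟨hs, ?_⟩, rfl⟩)
          rw [Nat.testBit_eq_decide_div_mod_eq, decide_eq_true_eq] at hk
          rw [Nat.shiftRight_eq_div_pow]
          rw [Nat.beq_eq]
          omega
      · exact hout g hg s hs
    refine List.forall_mem_cons.2 ⟨hZg, ih (g :: done) ?_ ?_ ?_ fun q hq => hsurv q (Or.inr hq)⟩
    · exact List.forall_mem_cons.2 ⟨hg, hdone⟩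
    · exact fun g' hg' => htodo g' (List.mem_cons_of_mem _ hg')
    · exact List.forall_mem_cons.2 ⟨hZg, hZdone⟩

theorem height_min (L : List ℕ) (h3 : ∀ b, height L 3 b = 0)
    (hge : ∀ a b, 3 ≤ a → height L a b = 0)
    (a b : ℕ) : height L (min a 3) (min b 5) = height L a b := by
  rcases le_total a 3 with ha | ha
  · rw [min_eq_left ha]
    rcases lt_or_ge b 5 with hb | hb
    · rw [min_eq_left hb.le]
    · rw [min_eq_right hb]
      simp [height, hb.not_gt]
  · rw [min_eq_right ha, h3, hge a b ha]

theorem exists_gen_le {L : List ℕ} (hge : ∀ a b, 3 ≤ a → height L a b = 0) {G : List Triple}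
    (hG : validGens L G = true) {t : Triple} (ht : height L t.1 t.2.1 ≤ t.2.2) :
    ∃ g ∈ G, g ≤ t := by
  simp only [validGens, force_eq, Bool.and_eq_true, List.all_eq_true, List.mem_range,
    List.any_eq_true, Nat.ble_eq] at hG
  obtain ⟨g, hg, ⟨h1, h2⟩, h3⟩ := hG.2 (min t.1 3) (by omega) (min t.2.1 5) (by omega)
  rw [height_min L (fun b => hge 3 b le_rfl) hge] at h3
  exact ⟨g, hg, h1.trans (min_le_left _ _), h2.trans (min_le_left _ _), h3.trans ht⟩

theorem inBox_of_validGens {L : List ℕ} {G : List Triple} (hG : validGens L G = true)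
    {g : Triple} (hg : g ∈ G) : InBox g ∧ height L g.1 g.2.1 ≤ g.2.2 := by
  simp only [validGens, force_eq, Bool.and_eq_true, List.all_eq_true, Nat.ble_eq] at hG
  obtain ⟨⟨⟨h1, h2⟩, h3⟩, h4⟩ := hG.1 g hg
  exact ⟨⟨h1, h2, h3⟩, h4⟩

theorem mem_of_mem_survivors {M : ℕ} {C G todo done : List Triple} {q : Triple × Triple}
    (hq : q ∈ survivors M C G done todo) : q.1 ∈ todo ∧ q.2 ∈ C := by
  induction todo generalizing done with
  | nil => simp [survivors] at hq
  | cons g todo ih =>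
    simp only [survivors, force_eq, List.mem_append, List.mem_map, List.mem_filter] at hq
    rcases hq with ⟨s, ⟨hs, -⟩, rfl⟩ | hq
    · exact ⟨by simp, hs⟩
    · exact ⟨List.mem_cons_of_mem _ (ih hq).1, (ih hq).2⟩

theorem height_le_sum (L : List ℕ) (a b : ℕ) : height L a b ≤ L.sum := by
  rw [height]
  split_ifs
  · rcases lt_or_ge (5 * a + b) L.length with h | h
    · rw [List.getD_eq_getElem _ _ h]
      exact List.single_le_sum (by simp) _ (List.getElem_mem h)
    · rw [List.getD_eq_default _ _ h]
      exact Nat.zero_le _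
  · exact Nat.zero_le _

/-- The list obeys the height bound along each of its prefixes, the reverse of the first prefix
being `l`. -/
def Extends : List ℕ → List ℕ → Prop
  | _, [] => True
  | l, v :: s => v ≤ bound l ∧ Extends (v :: l) s

theorem of_allBelow {q : ℕ → Bool} {n : ℕ} (h : allBelow q n = true) {v : ℕ} (hv : v ≤ n) :
    q v = true := by
  induction n with
  | zero =>
    obtain rfl := Nat.le_zero.1 hv
    exact h
  | succ n ih =>
    rw [allBelow, Bool.and_eq_true] at h
    rcases hv.eq_or_lt with rfl | hv
    · exact h.1
    · exact ih h.2 (Nat.lt_succ_iff.1 hv)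

theorem of_allExtensions {p : List ℕ → Bool} (s l : List ℕ)
    (h : allExtensions p s.length l s.sum = true) (hs : Extends l s) :
    p (l.reverse ++ s) = true := by
  induction s generalizing l with
  | nil => simpa [allExtensions] using h
  | cons v s ih =>
    rw [List.length_cons, List.sum_cons, allExtensions] at h
    have hv := of_allBelow h (v := v) (le_min (Nat.le_add_right _ _) hs.1)
    rw [force_eq, Nat.add_sub_cancel_left] at hv
    simpa using ih (v :: l) hv hs.2

set_option maxRecDepth 100000 in
theorem allExtensions_check : allExtensions check 15 [] 19 = true := by decide +kernel

/-- The list of heights with rows `0`, `1`, `2` and columns `0`, …, `4`. -/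
def heights (H : ℕ → ℕ → ℕ) : List ℕ :=
  [H 0 0, H 0 1, H 0 2, H 0 3, H 0 4, H 1 0, H 1 1, H 1 2, H 1 3, H 1 4,
    H 2 0, H 2 1, H 2 2, H 2 3, H 2 4]

theorem height_eq_zero_of_length {L : List ℕ} (hlen : L.length = 15) (a b : ℕ) (ha : 3 ≤ a) :
    height L a b = 0 := by
  rw [height]
  split_ifs
  · rw [List.getD_eq_default _ _ (by omega)]
  · rfl

theorem height_heights {H : ℕ → ℕ → ℕ} (h3 : ∀ a b, 3 ≤ a → H a b = 0)
    (h5 : ∀ a b, 5 ≤ b → H a b = 0) (a b : ℕ) : height (heights H) a b = H a b := by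
  rcases lt_or_ge a 3 with ha | ha
  · rcases lt_or_ge b 5 with hb | hb
    · interval_cases a <;> interval_cases b <;> rfl
    · rw [h5 a b hb, height, if_neg hb.not_gt]
  · rw [h3 a b ha, height_eq_zero_of_length rfl a b ha]

theorem check_heights {H : ℕ → ℕ → ℕ} (hcol : ∀ a b, H a (b + 1) ≤ H a b - 1)
    (hrow : ∀ a b, H (a + 1) b ≤ H a (b + 1)) (h5 : ∀ a, H a 5 = 0)
    (hsum : (heights H).sum = 19) : check (heights H) = true := by
  refine of_allExtensions (heights H) [] (by rw [hsum]; exact allExtensions_check) ?_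
  have h0 := hrow 0
  have h1 := hrow 1
  have c0 := hcol 0
  have c1 := hcol 1
  have c2 := hcol 2
  have h00 : H 0 0 ≤ 19 := by
    rw [← hsum]
    exact List.single_le_sum (by simp) _ (by simp [heights])
  simp only [heights, Extends, bound, force_eq, List.length_cons, List.length_nil, and_true]
  norm_num
  have := h0 0; have := h0 1; have := h0 2; have := h0 3; have := h0 4
  have := h1 0; have := h1 1; have := h1 2; have := h1 3; have := h1 4
  have := c0 0; have := c0 1; have := c0 2; have := c0 3
  have := c1 0; have := c1 1; have := c1 2; have := c1 3
  have := c2 0; have := c2 1; have := c2 2; have := c2 3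
  have := h5 0; have := h5 1
  simp only [zero_add, Nat.reduceAdd] at *
  omega

theorem heights_height {L : List ℕ} (hlen : L.length = 15) : heights (height L) = L := by
  refine List.ext_getElem hlen.symm fun i hi _ => ?_
  change i < 15 at hi
  interval_cases i <;> simp [heights, height, hlen]

/-- The exponents of the variables. -/
def units : List Triple := [(1, 0, 0), (0, 1, 0), (0, 0, 1)]

/-- The positions that a homomorphism forces to carry the same entry as `q`. -/
def moves (L : List ℕ) (q : Triple × Triple) : List (Triple × Triple) :=
  units.flatMap fun e =>
    (if (q.2 + e).2.2 < height L (q.2 + e).1 (q.2 + e).2.1 then [(q.1 + e, q.2 + e)] else []) ++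
    (if e ≤ q.1 ∧ height L (q.1 - e).1 (q.1 - e).2.1 ≤ (q.1 - e).2.2 then
      [(q.1 - e, q.2 - e)] else [])

/-- The positions reachable by moves. -/
def component (L : List ℕ) :
    ℕ → List (Triple × Triple) → List (Triple × Triple) → List (Triple × Triple)
  | n + 1, q :: todo, seen =>
    if q ∈ seen then component L n todo seen else component L n (moves L q ++ todo) (q :: seen)
  | _, _, seen => seen

/-- The indicator function of `U` is the matrix of a homomorphism. -/
def IsMoveClosed (L : List ℕ) (U : List (Triple × Triple)) : Prop :=
  ∀ q ∈ U, q.2.2.2 < height L q.2.1 q.2.2.1 ∧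
    (∀ e ∈ units, e ≤ q.1 → height L (q.1 - e).1 (q.1 - e).2.1 ≤ (q.1 - e).2.2 → e ≤ q.2) ∧
    ∀ q' ∈ moves L q, q' ∈ U

instance (L : List ℕ) (U : List (Triple × Triple)) : Decidable (IsMoveClosed L U) := by
  unfold IsMoveClosed
  infer_instance

/-- The component of each position of `P` is closed and meets `P` only there. -/
def IsSeparated (L : List ℕ) (P : List (Triple × Triple)) : Prop :=
  P.Nodup ∧ ∀ p ∈ P,
    IsMoveClosed L (component L 1000 [p] []) ∧ p ∈ component L 1000 [p] [] ∧
      ∀ q ∈ P, q ∈ component L 1000 [p] [] → q = p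

instance (L : List ℕ) (P : List (Triple × Triple)) : Decidable (IsSeparated L P) := by
  unfold IsSeparated
  exact instDecidableAnd

theorem isSeparated_square : IsSeparated [7, 4, 2, 0, 0, 4, 2, 0, 0, 0, 0, 0, 0, 0, 0]
    (survivorsOf [7, 4, 2, 0, 0, 4, 2, 0, 0, 0, 0, 0, 0, 0, 0]
      (gens [7, 4, 2, 0, 0, 4, 2, 0, 0, 0, 0, 0, 0, 0, 0])) := by
  decide +kernel

theorem isSeparated_cube : IsSeparated [4, 3, 2, 1, 0, 3, 2, 1, 0, 0, 2, 1, 0, 0, 0]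
    (survivorsOf [4, 3, 2, 1, 0, 3, 2, 1, 0, 0, 2, 1, 0, 0, 0]
      (gens [4, 3, 2, 1, 0, 3, 2, 1, 0, 0, 2, 1, 0, 0, 0])) := by
  decide +kernel

end Staircase

open Staircase

namespace MonomialIdeal

/-- The polynomial ring in three variables. -/
abbrev Poly : Type := MvPolynomial (Fin 3) ℂ

/-- The homomorphisms from an ideal to its quotient. -/
abbrev Tangent (I : Ideal Poly) : Type := ↥I →ₗ[Poly] (Poly ⧸ I)

variable {I : Ideal Poly}

theorem mem_of_forall_monomial_mem {p : Poly}
    (h : ∀ d ∈ p.support, monomial d (1 : ℂ) ∈ I) : p ∈ I := by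
  rw [p.as_sum]
  refine I.sum_mem fun d hd => ?_
  rw [← mul_one (coeff d p), ← C_mul_monomial]
  exact I.mul_mem_left _ (h d hd)

theorem monomial_mem_of_le {d e : Fin 3 →₀ ℕ} (hd : monomial d (1 : ℂ) ∈ I) (h : d ≤ e) :
    monomial e (1 : ℂ) ∈ I := by
  rw [← tsub_add_cancel_of_le h, ← one_mul (1 : ℂ), ← monomial_mul]
  exact I.mul_mem_left _ hd

open Classical in
/-- The coefficient functional of an exponent on the quotient by a monomial ideal; it is zero
when the monomial lies in the ideal. -/
noncomputable def coeffMod (I : Ideal Poly) (s : Fin 3 →₀ ℕ) : (Poly ⧸ I) →ₗ[ℂ] ℂ :=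
  if h : I.restrictScalars ℂ ≤ LinearMap.ker (lcoeff ℂ s : Poly →ₗ[ℂ] ℂ) then
    (Submodule.liftQ _ (lcoeff ℂ s) h) ∘ₗ
      (Submodule.Quotient.restrictScalarsEquiv ℂ I).symm.toLinearMap
  else 0

theorem coeffMod_mk (hI : IsMonomialIdeal I) {s : Fin 3 →₀ ℕ} (hs : monomial s (1 : ℂ) ∉ I)
    (p : Poly) : coeffMod I s (Ideal.Quotient.mk I p) = coeff s p := by
  have h : I.restrictScalars ℂ ≤ LinearMap.ker (lcoeff ℂ s : Poly →ₗ[ℂ] ℂ) := by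
    intro p hp
    rw [LinearMap.mem_ker, lcoeff_apply]
    by_contra hne
    exact hs (hI p hp s (mem_support_iff.2 hne))
  rw [coeffMod, dif_pos h]
  rfl

theorem coeffMod_eq_zero {s : Fin 3 →₀ ℕ} (hs : monomial s (1 : ℂ) ∈ I) : coeffMod I s = 0 := by
  refine dif_neg fun h => ?_
  have := h hs
  simp at this

theorem ext_coeffMod (hI : IsMonomialIdeal I) {q q' : Poly ⧸ I}
    (h : ∀ s, monomial s (1 : ℂ) ∉ I → coeffMod I s q = coeffMod I s q') : q = q' := by
  obtain ⟨p, rfl⟩ := Ideal.Quotient.mk_surjective q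
  obtain ⟨p', rfl⟩ := Ideal.Quotient.mk_surjective q'
  rw [Ideal.Quotient.eq]
  refine mem_of_forall_monomial_mem fun d hd => ?_
  by_contra hd'
  have := h d hd'
  rw [coeffMod_mk hI hd', coeffMod_mk hI hd'] at this
  rw [mem_support_iff, coeff_sub, this, sub_self] at hd
  exact hd rfl

theorem coeffMod_smul (hI : IsMonomialIdeal I) {s : Fin 3 →₀ ℕ} (hs : monomial s (1 : ℂ) ∉ I)
    (u : Fin 3 →₀ ℕ) (q : Poly ⧸ I) :
    coeffMod I s (monomial u (1 : ℂ) • q) = if u ≤ s then coeffMod I (s - u) q else 0 := by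
  obtain ⟨p, rfl⟩ := Ideal.Quotient.mk_surjective q
  have : (monomial u (1 : ℂ) : Poly) • Ideal.Quotient.mk I p
      = Ideal.Quotient.mk I (monomial u (1 : ℂ) * p) := rfl
  rw [this, coeffMod_mk hI hs, coeff_monomial_mul']
  refine if_congr Iff.rfl ?_ rfl
  rw [coeffMod_mk hI fun h => hs (monomial_mem_of_le h tsub_le_self), one_mul]

open Classical in
/-- The value of a homomorphism at a monomial, extended by zero outside the ideal. -/
noncomputable def evalMonomial (I : Ideal Poly) (d : Fin 3 →₀ ℕ) : Tangent I →ₗ[ℂ] (Poly ⧸ I) :=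
  if h : monomial d (1 : ℂ) ∈ I then
    { toFun := fun φ => φ ⟨_, h⟩
      map_add' := fun _ _ => rfl
      map_smul' := fun _ _ => rfl }
  else 0

theorem evalMonomial_apply {d : Fin 3 →₀ ℕ} (h : monomial d (1 : ℂ) ∈ I) (φ : Tangent I) :
    evalMonomial I d φ = φ ⟨_, h⟩ := by
  rw [evalMonomial, dif_pos h]
  rfl

theorem evalMonomial_add {d : Fin 3 →₀ ℕ} (h : monomial d (1 : ℂ) ∈ I) (u : Fin 3 →₀ ℕ)
    (φ : Tangent I) : evalMonomial I (u + d) φ = monomial u (1 : ℂ) • evalMonomial I d φ := by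
  have h' : monomial (u + d) (1 : ℂ) ∈ I := monomial_mem_of_le h le_add_self
  rw [evalMonomial_apply h, evalMonomial_apply h', ← map_smul]
  congr 1
  ext1
  simp [monomial_mul]

theorem eq_zero_of_evalMonomial (hI : IsMonomialIdeal I) {φ : Tangent I}
    (h : ∀ d, monomial d (1 : ℂ) ∈ I → evalMonomial I d φ = 0) : φ = 0 := by
  have key : ∀ p ∈ I, p ∈ (LinearMap.ker φ).map I.subtype := by
    intro p hp
    refine mem_of_forall_monomial_mem fun d hd => ?_
    have hd' := hI p hp d hd
    refine ⟨⟨_, hd'⟩, ?_, rfl⟩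
    rw [SetLike.mem_coe, LinearMap.mem_ker, ← evalMonomial_apply hd', h d hd']
  ext1 p
  obtain ⟨p', hp', e⟩ := key p p.2
  rw [← Subtype.ext e]
  exact hp'

/-- The coefficient at `s` of the value of a homomorphism at the monomial `d`. -/
noncomputable def entry (I : Ideal Poly) (d s : Fin 3 →₀ ℕ) : Tangent I →ₗ[ℂ] ℂ :=
  coeffMod I s ∘ₗ evalMonomial I d

/-- Comparing the two ways of multiplying the generators `d` and `e` up to a common multiple. -/
theorem entry_eq (hI : IsMonomialIdeal I) {d e u w s : Fin 3 →₀ ℕ} (hd : monomial d (1 : ℂ) ∈ I)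
    (he : monomial e (1 : ℂ) ∈ I) (h : u + d = w + e) (hs : monomial (s + u) (1 : ℂ) ∉ I)
    (φ : Tangent I) :
    entry I d s φ = if w ≤ s + u then entry I e (s + u - w) φ else 0 := by
  have h1 := coeffMod_smul hI hs u (evalMonomial I d φ)
  rw [← evalMonomial_add hd, h, evalMonomial_add he, coeffMod_smul hI hs, if_pos le_add_self,
    add_tsub_cancel_right] at h1
  exact h1.symm

/-- The exponent vector with the given entries. -/
noncomputable def toExp (t : Triple) : Fin 3 →₀ ℕ :=
  Finsupp.equivFunOnFinite.symm ![t.1, t.2.1, t.2.2]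

/-- The entries of an exponent vector. -/
def ofExp (d : Fin 3 →₀ ℕ) : Triple := (d 0, d 1, d 2)

@[simp] theorem ofExp_toExp (t : Triple) : ofExp (toExp t) = t := rfl

@[simp] theorem toExp_ofExp (d : Fin 3 →₀ ℕ) : toExp (ofExp d) = d := by
  ext i
  fin_cases i <;> rfl

theorem toExp_add (s t : Triple) : toExp (s + t) = toExp s + toExp t := by
  ext i
  fin_cases i <;> rfl

theorem toExp_sub (s t : Triple) : toExp (s - t) = toExp s - toExp t := by
  ext i
  fin_cases i <;> rfl

theorem toExp_le {s t : Triple} : toExp s ≤ toExp t ↔ s ≤ t := by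
  constructor
  · exact fun h => ⟨h 0, h 1, h 2⟩
  · rintro ⟨h0, h1, h2⟩ i
    fin_cases i
    exacts [h0, h1, h2]

/-- The monomials of the ideal `I` are those above the staircase with heights `L`. -/
def HasHeights (I : Ideal Poly) (L : List ℕ) : Prop :=
  ∀ t : Triple, monomial (toExp t) (1 : ℂ) ∈ I ↔ height L t.1 t.2.1 ≤ t.2.2

theorem HasHeights.mem_cells {L : List ℕ} (h : HasHeights I L)
    (hge : ∀ a b, 3 ≤ a → height L a b = 0) {t : Triple} :
    t ∈ cells L ↔ monomial (toExp t) (1 : ℂ) ∉ I := by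
  rw [h, not_le, Staircase.mem_cells, and_iff_right_of_imp, and_iff_right_of_imp]
  · intro ht
    by_contra hb
    simp [height, hb] at ht
  · rintro ⟨-, ht⟩
    by_contra ha
    rw [hge _ _ (not_lt.1 ha)] at ht
    exact absurd ht (Nat.not_lt_zero _)

theorem eq_zero_of_survivors (hI : IsMonomialIdeal I) {L : List ℕ} (h : HasHeights I L)
    (hge : ∀ a b, 3 ≤ a → height L a b = 0) (hL : ∀ a b, height L a b ≤ 19) {G : List Triple}
    (hG : validGens L G = true) {φ : Tangent I}
    (hφ : ∀ q ∈ survivorsOf L G, entry I (toExp q.1) (toExp q.2) φ = 0) : φ = 0 := by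
  have hmem : ∀ g ∈ G, monomial (toExp g) (1 : ℂ) ∈ I := fun g hg =>
    (h g).2 (inBox_of_validGens hG hg).2
  have hjoin : ∀ g h : Triple,
      toExp (join g h - g) + toExp g = toExp (join g h - h) + toExp h := fun g h => by
    rw [← toExp_add, ← toExp_add, join_sub_add_left, join_sub_add_right]
  have hrel : ∀ g ∈ G, ∀ e ∈ G, ∀ s, s + (join g e - g) ∈ cells L →
      entry I (toExp g) (toExp s) φ = if join g e - e ≤ s + (join g e - g) then
        entry I (toExp e) (toExp (s + (join g e - g) - (join g e - e))) φ else 0 := by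
    intro g hg e he s hs
    rw [entry_eq hI (hmem g hg) (hmem e he) (hjoin g e)
      (by rw [← toExp_add]; exact (h.mem_cells hge).1 hs)]
    simp only [← toExp_add, ← toExp_sub, toExp_le]
  have hall : ∀ g ∈ G, ∀ s, entry I (toExp g) (toExp s) φ = 0 := by
    refine forall_of_survivors hL ?_ (fun g hg => (inBox_of_validGens hG hg).1)
      (fun g s => entry I (toExp g) (toExp s) φ = 0) ?_ ?_ ?_ [] G (by simp) (fun _ h => h)
      (by simp) ?_
    · intro t ht t' htt'
      rw [h.mem_cells hge] at ht ⊢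
      exact fun h' => ht (monomial_mem_of_le h' (toExp_le.2 htt'))
    · intro g _ s hs
      rw [h.mem_cells hge, not_not] at hs
      rw [entry, coeffMod_eq_zero hs, LinearMap.zero_comp, LinearMap.zero_apply]
    · intro g hg e he s hs hz
      rw [hrel g hg e he s hs, hz, ite_self]
    · intro g hg e he s hs hlt
      rw [hrel g hg e he s hs, if_neg hlt]
    · intro q hq
      exact hφ q (by rwa [survivorsOf, force_eq])
  refine eq_zero_of_evalMonomial hI fun d hd => ?_
  rw [← toExp_ofExp d, h] at hd
  obtain ⟨g, hg, hle⟩ := exists_gen_le hge hG hd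
  have hle' : toExp g ≤ d := by rwa [← toExp_ofExp d, toExp_le]
  have hzero : evalMonomial I (toExp g) φ = 0 := by
    refine ext_coeffMod hI fun s _ => ?_
    have := hall g hg (ofExp s)
    rw [toExp_ofExp] at this
    rw [map_zero]
    exact this
  rw [← tsub_add_cancel_of_le hle', evalMonomial_add (hmem g hg), hzero, smul_zero]

/-- The entries of a homomorphism at a list of positions. -/
noncomputable def entries (I : Ideal Poly) (P : List (Triple × Triple)) :
    Tangent I →ₗ[ℂ] (Fin P.length → ℂ) :=
  LinearMap.pi fun i => entry I (toExp (P.get i).1) (toExp (P.get i).2)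

theorem entries_injective (hI : IsMonomialIdeal I) {L : List ℕ} (h : HasHeights I L)
    (hge : ∀ a b, 3 ≤ a → height L a b = 0) (hL : ∀ a b, height L a b ≤ 19) {G : List Triple}
    (hG : validGens L G = true) : Function.Injective (entries I (survivorsOf L G)) := by
  rw [injective_iff_map_eq_zero]
  refine fun φ hφ => eq_zero_of_survivors hI h hge hL hG fun q hq => ?_
  obtain ⟨i, rfl⟩ := List.mem_iff_get.1 hq
  exact congrFun hφ i

theorem tangentDim_le (hI : IsMonomialIdeal I) {L : List ℕ} (h : HasHeights I L)
    (hge : ∀ a b, 3 ≤ a → height L a b = 0) (hL : ∀ a b, height L a b ≤ 19) {G : List Triple}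
    (hG : validGens L G = true) : tangentDim I ≤ (survivorsOf L G).length := by
  have := LinearMap.finrank_le_finrank_of_injective (entries_injective hI h hge hL hG)
  rwa [Module.finrank_fin_fun] at this

theorem finrank_quotient (hI : IsMonomialIdeal I) :
    Module.finrank ℂ (Poly ⧸ I) = Nat.card {t : Triple // monomial (toExp t) (1 : ℂ) ∉ I} := by
  let v : {t : Triple // monomial (toExp t) (1 : ℂ) ∉ I} → Poly ⧸ I := fun t =>
    Ideal.Quotient.mk I (monomial (toExp t) 1)
  have hv : ∀ s t, coeffMod I (toExp (s : {t // monomial (toExp t) (1 : ℂ) ∉ I})) (v t)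
      = if t = s then 1 else 0 := by
    intro s t
    rw [coeffMod_mk hI s.2, coeff_monomial]
    refine if_congr ?_ rfl rfl
    rw [Subtype.ext_iff]
    exact ⟨fun e => by simpa using congrArg ofExp e, fun e => by rw [e]⟩
  have hli : LinearIndependent ℂ v := by
    rw [linearIndependent_iff']
    intro F c hc s hs
    have := congrArg (coeffMod I (toExp s)) hc
    simpa [hv, hs] using this
  have hspan : ⊤ ≤ Submodule.span ℂ (Set.range v) := by
    rintro q -
    obtain ⟨p, rfl⟩ := Ideal.Quotient.mk_surjective q
    rw [p.as_sum, map_sum]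
    refine Submodule.sum_mem _ fun d _ => ?_
    by_cases hd : monomial d (1 : ℂ) ∈ I
    · have : monomial d (coeff d p) ∈ I := by
        rw [← mul_one (coeff d p), ← C_mul_monomial]
        exact I.mul_mem_left _ hd
      rw [Ideal.Quotient.eq_zero_iff_mem.2 this]
      exact Submodule.zero_mem _
    · have : Ideal.Quotient.mk I (monomial d (coeff d p))
          = coeff d p • v ⟨ofExp d, by rwa [toExp_ofExp]⟩ := by
        simp only [v, toExp_ofExp]
        rw [← mul_one (coeff d p), ← smul_eq_mul, ← smul_monomial, smul_eq_mul, mul_one]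
        rfl
      rw [this]
      exact Submodule.smul_mem _ _ (Submodule.subset_span ⟨_, rfl⟩)
  exact Module.finrank_eq_nat_card_basis (Module.Basis.mk hli hspan)

theorem finrank_quotient_of_hasHeights (hI : IsMonomialIdeal I) {H : ℕ → ℕ → ℕ}
    (h : HasHeights I (heights H)) :
    Module.finrank ℂ (Poly ⧸ I) = (heights H).sum := by
  have hge := height_eq_zero_of_length (L := heights H) rfl
  rw [finrank_quotient hI]
  let e : (Σ p : Fin 3 × Fin 5, Fin (height (heights H) p.1 p.2)) ≃
      {t : Triple // monomial (toExp t) (1 : ℂ) ∉ I} :=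
    { toFun := fun x => ⟨(x.1.1, x.1.2, x.2), (h.mem_cells hge).1
        (mem_cells.2 ⟨x.1.1.2, x.1.2.2, x.2.2⟩)⟩
      invFun := fun t =>
        have ht := mem_cells.1 ((h.mem_cells hge).2 t.2)
        ⟨(⟨t.1.1, ht.1⟩, ⟨t.1.2.1, ht.2.1⟩), ⟨t.1.2.2, ht.2.2⟩⟩
      left_inv := fun _ => rfl
      right_inv := fun _ => rfl }
  rw [← Nat.card_congr e, Nat.card_sigma]
  simp only [Nat.card_eq_fintype_card, Fintype.card_fin, Fintype.sum_prod_type, Fin.sum_univ_succ,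
    Fin.sum_univ_zero]
  simp [heights, height]
  ring

theorem borel_step (hB : IsBorelFixed I) {s t : Triple} {i j : Fin 3} (hij : i < j)
    (h : toExp s + Finsupp.single i 1 = toExp t + Finsupp.single j 1) (hj : 0 < toExp s j)
    (hs : monomial (toExp s) (1 : ℂ) ∈ I) : monomial (toExp t) (1 : ℂ) ∈ I := by
  have := hB _ hs i j hij hj
  rwa [h, add_tsub_cancel_right] at this

theorem exists_heights (hB : IsBorelFixed I)
    (hfin : Finite {t : Triple // monomial (toExp t) (1 : ℂ) ∉ I}) :
    ∃ H : ℕ → ℕ → ℕ, (∀ t : Triple, monomial (toExp t) (1 : ℂ) ∈ I ↔ H t.1 t.2.1 ≤ t.2.2) ∧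
      (∀ a b, H (a + 1) b ≤ H a b) ∧ (∀ a b, H a (b + 1) ≤ H a b - 1) ∧
      ∀ a b, H (a + 1) b ≤ H a (b + 1) := by
  classical
  have hex : ∀ a b, ∃ c, monomial (toExp (a, b, c)) (1 : ℂ) ∈ I := by
    intro a b
    by_contra! hcon
    refine not_injective_infinite_finite
      (fun c : ℕ => (⟨(a, b, c), hcon c⟩ : {t : Triple // monomial (toExp t) (1 : ℂ) ∉ I})) ?_
    intro c c' e
    simpa using e
  have hmem : ∀ a b, monomial (toExp (a, b, Nat.find (hex a b))) (1 : ℂ) ∈ I := fun a b =>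
    Nat.find_spec (hex a b)
  refine ⟨fun a b => Nat.find (hex a b), ?_, ?_, ?_, ?_⟩
  · rintro ⟨a, b, c⟩
    exact ⟨fun h => Nat.find_min' _ h, fun h =>
      monomial_mem_of_le (hmem a b) (toExp_le.2 ⟨le_rfl, le_rfl, h⟩)⟩
  · exact fun a b => Nat.find_min' _
      (monomial_mem_of_le (hmem a b) (toExp_le.2 ⟨Nat.le_succ a, le_rfl, le_rfl⟩))
  · intro a b
    have key : ∀ c, monomial (toExp (a, b, c)) (1 : ℂ) ∈ I →
        monomial (toExp (a, b + 1, c - 1)) (1 : ℂ) ∈ I := by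
      rintro (_ | c) h
      · exact monomial_mem_of_le h (toExp_le.2 ⟨le_rfl, Nat.le_succ b, le_rfl⟩)
      · refine borel_step hB (i := 1) (j := 2) (by decide) ?_
          (show 0 < toExp (a, b, c + 1) 2 from Nat.succ_pos c) h
        ext i
        fin_cases i <;> simp [toExp]
    exact Nat.find_min' _ (key _ (hmem a b))
  · intro a b
    refine Nat.find_min' _ ?_
    refine borel_step hB (i := 0) (j := 1) (by decide) ?_
      (show 0 < toExp (a, b + 1, _) 1 from Nat.succ_pos b) (hmem a (b + 1))
    ext i
    fin_cases i <;> simp [toExp]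

theorem X_zero_pow_mem {m : ℕ} :
    (X 0 : Poly) ^ m ∈ I ↔ monomial (toExp (m, 0, 0)) (1 : ℂ) ∈ I := by
  rw [X_pow_eq_monomial]
  have : toExp (m, 0, 0) = Finsupp.single 0 m := by
    ext i
    fin_cases i <;> simp [toExp]
  rw [this]

theorem tangentDim_le_target (hI : IsMonomialIdeal I) (hB : IsBorelFixed I)
    (hcolength : Module.finrank ℂ (Poly ⧸ I) = 19) (hcube : (X 0 : Poly) ^ 3 ∈ I) :
    ∃ L : List ℕ, HasHeights I L ∧ tangentDim I ≤ target L := by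
  have hcard := hcolength
  rw [finrank_quotient hI] at hcard
  have hfin : Finite {t : Triple // monomial (toExp t) (1 : ℂ) ∉ I} :=
    Nat.finite_of_card_ne_zero (by omega)
  obtain ⟨H, hH, hanti, hcol, hrow⟩ := exists_heights hB hfin
  have hcol' : ∀ a, Antitone (H a) := fun a =>
    antitone_nat_of_succ_le fun b => (hcol a b).trans (Nat.sub_le _ _)
  have h3 : ∀ a b, 3 ≤ a → H a b = 0 := by
    intro a b ha
    have h30 : H 3 0 ≤ 0 := (hH (3, 0, 0)).1 (X_zero_pow_mem.1 hcube)
    have h1 : H a 0 ≤ H 3 0 := antitone_nat_of_succ_le (f := fun a => H a 0)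
      (fun a => hanti a 0) ha
    have h2 := hcol' a (Nat.zero_le b)
    omega
  have h05 : H 0 5 = 0 := by
    by_contra h05
    let f : (Σ b : Fin 6, Fin (H 0 b)) → {t : Triple // monomial (toExp t) (1 : ℂ) ∉ I} :=
      fun x => ⟨(0, x.1, x.2), fun h => absurd ((hH _).1 h) x.2.2.not_ge⟩
    have hf : Function.Injective f := by
      rintro ⟨b, c⟩ ⟨b', c'⟩ e
      have e' := congrArg Subtype.val e
      simp only [f, Prod.mk.injEq, true_and] at e'
      obtain rfl := Fin.ext e'.1
      obtain rfl := Fin.ext e'.2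
      rfl
    have := Nat.card_le_card_of_injective f hf
    rw [hcard, Nat.card_sigma] at this
    simp only [Nat.card_eq_fintype_card, Fintype.card_fin, Fin.sum_univ_succ,
      Fin.sum_univ_zero] at this
    have h0 := hcol 0 0
    have h1 := hcol 0 1
    have h2 := hcol 0 2
    have h3 := hcol 0 3
    have h4 := hcol 0 4
    simp at this h0 h1 h2 h3 h4
    omega
  have h5 : ∀ a b, 5 ≤ b → H a b = 0 := by
    intro a b hb
    have h1 : H a b ≤ H 0 b := antitone_nat_of_succ_le (f := fun a => H a b)
      (fun a => hanti a b) (Nat.zero_le a)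
    have h2 := hcol' 0 hb
    omega
  have hL : HasHeights I (heights H) := fun t => by rw [height_heights h3 h5, hH]
  have hsum : (heights H).sum = 19 := by rw [← finrank_quotient_of_hasHeights hI hL, hcolength]
  have hcheck := check_heights hcol hrow (fun a => h5 a 5 le_rfl) hsum
  rw [check, Bool.and_eq_true, Nat.ble_eq] at hcheck
  exact ⟨heights H, hL, le_trans (tangentDim_le hI hL (height_eq_zero_of_length rfl)
    (fun a b => (height_le_sum _ a b).trans hsum.le) hcheck.1) hcheck.2⟩

theorem tangentDim_le_of_cube (hI : IsMonomialIdeal I) (hB : IsBorelFixed I)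
    (hcolength : Module.finrank ℂ (Poly ⧸ I) = 19) (h : (X 0 : Poly) ^ 3 ∈ I) :
    tangentDim I ≤ 123 := by
  obtain ⟨L, -, hT⟩ := tangentDim_le_target hI hB hcolength h
  refine hT.trans ?_
  unfold target
  cases (height L 1 0).beq 0 <;> cases (height L 2 0).beq 0 <;> decide

theorem tangentDim_le_of_square (hI : IsMonomialIdeal I) (hB : IsBorelFixed I)
    (hcolength : Module.finrank ℂ (Poly ⧸ I) = 19) (h : (X 0 : Poly) ^ 2 ∈ I) :
    tangentDim I ≤ 89 := by
  obtain ⟨L, hL, hT⟩ := tangentDim_le_target hI hB hcolength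
    (I.pow_mem_of_pow_mem h (by norm_num))
  refine hT.trans ?_
  have h20 : height L 2 0 = 0 := Nat.le_zero.1 ((hL (2, 0, 0)).1 (X_zero_pow_mem.1 h))
  unfold target
  rw [h20]
  cases (height L 1 0).beq 0 <;> decide

theorem tangentDim_le_of_linear (hI : IsMonomialIdeal I) (hB : IsBorelFixed I)
    (hcolength : Module.finrank ℂ (Poly ⧸ I) = 19) (h : (X 0 : Poly) ^ 1 ∈ I) :
    tangentDim I ≤ 88 := by
  obtain ⟨L, hL, hT⟩ := tangentDim_le_target hI hB hcolength
    (I.pow_mem_of_pow_mem h (by norm_num))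
  refine hT.trans ?_
  have h10 : height L 1 0 = 0 := Nat.le_zero.1 ((hL (1, 0, 0)).1 (X_zero_pow_mem.1 h))
  unfold target
  rw [h10]
  cases (height L 2 0).beq 0 <;> decide

/-- The linear map sending each monomial to the sum of the monomials paired with it in `U`. -/
noncomputable def pairing (I : Ideal Poly) (U : List (Triple × Triple)) : Poly →ₗ[ℂ] (Poly ⧸ I) :=
  (basisMonomials (Fin 3) ℂ).constr ℂ fun d =>
    Ideal.Quotient.mk I (∑ q ∈ U.toFinset with q.1 = ofExp d, monomial (toExp q.2) 1)

theorem coeffMod_pairing (hI : IsMonomialIdeal I) (U : List (Triple × Triple))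
    (d : Fin 3 →₀ ℕ) {s : Fin 3 →₀ ℕ} (hs : monomial s (1 : ℂ) ∉ I) :
    coeffMod I s (pairing I U (monomial d 1)) = if (ofExp d, ofExp s) ∈ U then 1 else 0 := by
  have h : pairing I U (monomial d 1) = Ideal.Quotient.mk I
      (∑ q ∈ U.toFinset with q.1 = ofExp d, monomial (toExp q.2) 1) := by
    exact (basisMonomials (Fin 3) ℂ).constr_basis ℂ _ d
  rw [h, coeffMod_mk hI hs, coeff_sum]
  have : ∀ q : Triple × Triple, q ∈ U.toFinset.filter (fun q => q.1 = ofExp d) →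
      coeff s (monomial (toExp q.2) (1 : ℂ)) = if q = (ofExp d, ofExp s) then 1 else 0 := by
    rintro ⟨q1, q2⟩ hq
    obtain rfl : q1 = ofExp d := (Finset.mem_filter.1 hq).2
    rw [coeff_monomial]
    refine if_congr ?_ rfl rfl
    rw [Prod.mk.injEq, and_iff_right rfl]
    exact ⟨fun e => by rw [← e, ofExp_toExp], fun e => by rw [e, toExp_ofExp]⟩
  rw [Finset.sum_congr rfl this, Finset.sum_ite_eq']
  simp

theorem pairing_monomial_add (hI : IsMonomialIdeal I) {L : List ℕ} (h : HasHeights I L)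
    {U : List (Triple × Triple)} (hU : IsMoveClosed L U) {d : Triple}
    (hd : monomial (toExp d) (1 : ℂ) ∈ I) {e : Triple} (he : e ∈ units) :
    pairing I U (monomial (toExp (d + e)) 1)
      = monomial (toExp e) (1 : ℂ) • pairing I U (monomial (toExp d) 1) := by
  refine ext_coeffMod hI fun s hs => ?_
  obtain ⟨s, rfl⟩ : ∃ t, toExp t = s := ⟨ofExp s, toExp_ofExp s⟩
  rw [coeffMod_smul hI hs, coeffMod_pairing hI U _ hs]
  simp only [toExp_le]
  have hs' : s.2.2 < height L s.1 s.2.1 := by rwa [h, not_le] at hs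
  split_ifs with h1 h2 h2
  · rw [← toExp_sub, coeffMod_pairing hI]
    · refine (if_pos ((hU _ h1).2.2 _ ?_)).symm
      refine List.mem_flatMap.2 ⟨e, he, List.mem_append.2 (Or.inr ?_)⟩
      simp only [ofExp_toExp, add_tsub_cancel_right]
      rw [if_pos ⟨le_add_self, (h d).1 hd⟩]
      simp
    · exact fun h' => hs (monomial_mem_of_le h' (toExp_le.2 tsub_le_self))
  · refine absurd ((hU _ h1).2.1 e he ?_ ?_) h2
    · exact le_add_self
    · simp only [ofExp_toExp, add_tsub_cancel_right]
      exact (h d).1 hd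
  · rw [← toExp_sub, coeffMod_pairing hI]
    · refine (if_neg fun h3 => h1 ?_).symm
      refine (hU _ h3).2.2 _ (List.mem_flatMap.2 ⟨e, he, List.mem_append.2 (Or.inl ?_)⟩)
      simp only [ofExp_toExp, tsub_add_cancel_of_le h2]
      rw [if_pos hs']
      simp
    · exact fun h' => hs (monomial_mem_of_le h' (toExp_le.2 tsub_le_self))
  · rfl

theorem exists_unit (i : Fin 3) : ∃ e ∈ units, toExp e = Finsupp.single i 1 := by
  fin_cases i
  · exact ⟨(1, 0, 0), by decide, by ext j; fin_cases j <;> simp [toExp]⟩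
  · exact ⟨(0, 1, 0), by decide, by ext j; fin_cases j <;> simp [toExp]⟩
  · exact ⟨(0, 0, 1), by decide, by ext j; fin_cases j <;> simp [toExp]⟩

theorem pairing_X_mul (hI : IsMonomialIdeal I) {L : List ℕ} (h : HasHeights I L)
    {U : List (Triple × Triple)} (hU : IsMoveClosed L U) (i : Fin 3) {p : Poly} (hp : p ∈ I) :
    pairing I U (X i * p) = (X i : Poly) • pairing I U p := by
  rw [p.as_sum, Finset.mul_sum, map_sum, map_sum, Finset.smul_sum]
  refine Finset.sum_congr rfl fun d hd => ?_
  obtain ⟨e, he, hei⟩ := exists_unit i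
  have hm := hI p hp d hd
  rw [← toExp_ofExp d] at hm
  have key := pairing_monomial_add hI h hU hm he
  rw [toExp_add, toExp_ofExp, hei] at key
  have h1 : monomial d (coeff d p) = coeff d p • (monomial d 1 : Poly) := by
    rw [smul_monomial, smul_eq_mul, mul_one]
  rw [h1, mul_smul_comm, map_smul, map_smul, smul_comm (X i : Poly), X, monomial_mul, mul_one,
    add_comm, key]

/-- The homomorphism whose matrix is the indicator function of a closed set of positions. -/
theorem exists_tangent (hI : IsMonomialIdeal I) {L : List ℕ} (h : HasHeights I L)
    {U : List (Triple × Triple)} (hU : IsMoveClosed L U) :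
    ∃ φ : Tangent I, ∀ d s : Triple, monomial (toExp d) (1 : ℂ) ∈ I →
      monomial (toExp s) (1 : ℂ) ∉ I →
      entry I (toExp d) (toExp s) φ = if (d, s) ∈ U then 1 else 0 := by
  have hmul : ∀ r p : Poly, p ∈ I → pairing I U (r * p) = r • pairing I U p := by
    intro r
    induction r using MvPolynomial.induction_on with
    | C a =>
      intro p _
      rw [C_mul', map_smul, ← algebraMap_eq, algebraMap_smul]
    | add r r' hr hr' =>
      intro p hp
      rw [add_mul, map_add, hr p hp, hr' p hp, add_smul]
    | mul_X r i hr =>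
      intro p hp
      rw [mul_assoc, hr _ (I.mul_mem_left _ hp), pairing_X_mul hI h hU i hp, mul_smul]
  refine ⟨{ toFun := fun p => pairing I U p
            map_add' := fun p q => map_add _ _ _
            map_smul' := fun r p => hmul r p p.2 }, fun d s hd hs => ?_⟩
  rw [entry, LinearMap.comp_apply, evalMonomial_apply hd]
  exact coeffMod_pairing hI U (toExp d) hs

theorem tangentDim_eq (hI : IsMonomialIdeal I) {L : List ℕ} (h : HasHeights I L)
    (hge : ∀ a b, 3 ≤ a → height L a b = 0) (hL : ∀ a b, height L a b ≤ 19) {G : List Triple}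
    (hG : validGens L G = true) (hsep : IsSeparated L (survivorsOf L G)) :
    tangentDim I = (survivorsOf L G).length := by
  refine (tangentDim_le hI h hge hL hG).antisymm ?_
  have hinj := entries_injective hI h hge hL hG
  have hsurj : Function.Surjective (entries I (survivorsOf L G)) := by
    rw [← LinearMap.range_eq_top, eq_top_iff, ← (Pi.basisFun ℂ _).span_eq, Submodule.span_le]
    rintro _ ⟨i, rfl⟩
    obtain ⟨hclosed, hmem, hsingle⟩ := hsep.2 _ (List.get_mem _ i)
    obtain ⟨φ, hφ⟩ := exists_tangent hI h hclosed
    refine ⟨φ, funext fun j => ?_⟩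
    have hj := mem_of_mem_survivors
      (by simpa only [survivorsOf, force_eq] using List.get_mem (survivorsOf L G) j)
    rw [Pi.basisFun_apply, Pi.single_apply]
    refine (hφ _ _ ((h _).2 (inBox_of_validGens hG hj.1).2) ((h.mem_cells hge).1 hj.2)).trans ?_
    refine if_congr ⟨fun hU => ?_, fun e => ?_⟩ rfl rfl
    · exact List.nodup_iff_injective_get.1 hsep.1 (hsingle _ (List.get_mem _ j) hU)
    · rw [e]
      exact hmem
  have := (LinearEquiv.ofBijective _ ⟨hinj, hsurj⟩).finrank_eq
  rw [Module.finrank_fin_fun] at this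
  exact this.ge

/-- The ideal spanned by the monomials above the staircase with heights `L`. -/
noncomputable def ofHeights (L : List ℕ) : Ideal Poly :=
  Ideal.span ((fun d => monomial d (1 : ℂ)) '' {d | height L (d 0) (d 1) ≤ d 2})

theorem mem_ofHeights {L : List ℕ} (hrow : ∀ b, Antitone fun a => height L a b)
    (hcol : ∀ a, Antitone (height L a)) {p : Poly} :
    p ∈ ofHeights L ↔ ∀ d ∈ p.support, height L (d 0) (d 1) ≤ d 2 := by
  rw [ofHeights, mem_ideal_span_monomial_image]
  refine forall₂_congr fun d _ => ⟨?_, fun h => ⟨d, h, le_rfl⟩⟩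
  rintro ⟨e, he, hle⟩
  exact (hrow _ (hle 0)).trans ((hcol _ (hle 1)).trans (he.trans (hle 2)))

/-- The inequalities on the heights of a strongly stable ideal. -/
def IsStable (L : List ℕ) : Prop :=
  ∀ a < 3, ∀ b < 5, height L (a + 1) b ≤ height L a (b + 1) ∧ height L a (b + 1) ≤ height L a b - 1

instance (L : List ℕ) : Decidable (IsStable L) := by
  unfold IsStable
  infer_instance

theorem height_succ_le {L : List ℕ} (hge : ∀ a b, 3 ≤ a → height L a b = 0) (hL : IsStable L)
    (a b : ℕ) : height L (a + 1) b ≤ height L a (b + 1) ∧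
      height L a (b + 1) ≤ height L a b - 1 := by
  by_cases ha : a < 3
  · by_cases hb : b < 5
    · exact hL a ha b hb
    · have hzero : ∀ a b', b ≤ b' → height L a b' = 0 := fun a b' hb' => if_neg (by omega)
      rw [hzero _ _ le_rfl, hzero _ (b + 1) (Nat.le_succ b)]
      simp
  · rw [hge a _ (not_lt.1 ha), hge (a + 1) b (by omega)]
    simp

theorem exists_ideal {L : List ℕ} (hlen : L.length = 15) (hL : IsStable L) :
    ∃ I : Ideal Poly, IsMonomialIdeal I ∧ IsBorelFixed I ∧ HasHeights I L := by
  have hge := height_eq_zero_of_length hlen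
  have hstable := height_succ_le hge hL
  have hcol : ∀ a, Antitone (height L a) := fun a =>
    antitone_nat_of_succ_le fun b => (hstable a b).2.trans (Nat.sub_le _ _)
  have hrow : ∀ b, Antitone fun a => height L a b := fun b =>
    antitone_nat_of_succ_le fun a => (hstable a b).1.trans (hcol a (Nat.le_succ b))
  have hmem : ∀ d, monomial d (1 : ℂ) ∈ ofHeights L ↔ height L (d 0) (d 1) ≤ d 2 := by
    intro d
    rw [mem_ofHeights hrow hcol]
    simp
  refine ⟨ofHeights L, ?_, ?_, fun t => hmem (toExp t)⟩
  · intro p hp d hd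
    exact (hmem d).2 ((mem_ofHeights hrow hcol).1 hp d hd)
  · intro d hd i j hij hj
    rw [hmem] at hd ⊢
    have h0 := hstable (d 0) (d 1 - 1)
    have h1 := hstable (d 0) (d 1)
    have h2 := hcol (d 0) (Nat.le_succ (d 1))
    have h3 := hrow (d 1) (Nat.le_succ (d 0))
    fin_cases i <;> fin_cases j <;> simp at hij hj ⊢
    · rw [Nat.sub_add_cancel hj] at h0
      exact h0.1.trans hd
    · dsimp at h3
      omega
    · omega

theorem exists_ideal_tangentDim {L : List ℕ} (hlen : L.length = 15) (hL : IsStable L)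
    (hsum : L.sum = 19) (hG : validGens L (gens L) = true)
    (hsep : IsSeparated L (survivorsOf L (gens L))) :
    ∃ I : Ideal Poly, IsMonomialIdeal I ∧ IsBorelFixed I ∧ HasHeights I L ∧
      Module.finrank ℂ (Poly ⧸ I) = 19 ∧ tangentDim I = (survivorsOf L (gens L)).length := by
  obtain ⟨I, hI, hB, h⟩ := exists_ideal hlen hL
  have hh : HasHeights I (heights (height L)) := by rwa [heights_height hlen]
  refine ⟨I, hI, hB, h, ?_, tangentDim_eq hI h (height_eq_zero_of_length hlen)
    (fun a b => (height_le_sum L a b).trans hsum.le) hG hsep⟩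
  rw [finrank_quotient_of_hasHeights hI hh, heights_height hlen, hsum]

end MonomialIdeal

open MonomialIdeal in
theorem Tmax_monotonicity_l19 :
    TmaxEq 19 2 89 ∧
    TmaxEq 19 3 123 ∧
    (∀ T1 T2 T3 : ℕ, TmaxEq 19 1 T1 → TmaxEq 19 2 T2 → TmaxEq 19 3 T3 →
      T1 < T2 ∧ T2 < T3) := by
  have hsquare : TmaxEq 19 2 89 := by
    constructor
    · obtain ⟨I, hI, hB, h, hcolength, hT⟩ := exists_ideal_tangentDim rfl (by decide) rfl
        (by decide +kernel) isSeparated_square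
      refine ⟨I, hI, hB, hcolength, X_zero_pow_mem.2 ((h _).2 (by decide)), fun hX => ?_, ?_⟩
      · exact absurd ((h _).1 (X_zero_pow_mem.1 hX)) (by decide)
      · rw [hT]
        decide +kernel
    · rintro _ ⟨I, hI, hB, hcolength, hX, -, rfl⟩
      exact tangentDim_le_of_square hI hB hcolength hX
  have hcube : TmaxEq 19 3 123 := by
    constructor
    · obtain ⟨I, hI, hB, h, hcolength, hT⟩ := exists_ideal_tangentDim rfl (by decide) rfl
        (by decide +kernel) isSeparated_cube
      refine ⟨I, hI, hB, hcolength, X_zero_pow_mem.2 ((h _).2 (by decide)), fun hX => ?_, ?_⟩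
      · exact absurd ((h _).1 (X_zero_pow_mem.1 hX)) (by decide)
      · rw [hT]
        decide +kernel
    · rintro _ ⟨I, hI, hB, hcolength, hX, -, rfl⟩
      exact tangentDim_le_of_cube hI hB hcolength hX
  refine ⟨hsquare, hcube, fun T1 T2 T3 h1 h2 h3 => ?_⟩
  obtain rfl := h2.unique hsquare
  obtain rfl := h3.unique hcube
  obtain ⟨I, hI, hB, hcolength, hX, -, rfl⟩ := h1.1
  exact ⟨(tangentDim_le_of_linear hI hB hcolength hX).trans_lt (by norm_num), by norm_num⟩
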